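/- Let w ∈ ℝ^n have all entries strictly positive, b ∈ ℝ, σ : ℝ → ℝ continuous satisfying the STFE property with σ(b) = 0, and f(x) = σ(wᵀx + b) on [0,1]^n. Fix i and let y be in the interior of R_i such that conc(f_{−i},[0,1]^{n−1}) is differentiable at y_{−i}/y_i (so that g is differentiable at y). Then for every x ∈ (0,1)^n with x ∉ R_i ∪ R_f, f(x) ≤ g(y) + ∇g(y)ᵀ(x − y). -/

import Mathlib

noncomputable section

/-- `φ` is the concave envelope of `f` over `S`: the pointwise smallest concave
function on `S` that majorizes `f` on `S`. -/
def IsConcaveEnvelope {E : Type*} [AddCommMonoid E] [Module ℝ E]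
    (S : Set E) (f φ : E → ℝ) : Prop :=
  ConcaveOn ℝ S φ ∧ (∀ x ∈ S, f x ≤ φ x) ∧
    ∀ h : E → ℝ, ConcaveOn ℝ S h → (∀ x ∈ S, f x ≤ h x) → ∀ x ∈ S, φ x ≤ h x

/-- `φ` is the convex envelope of `f` over `S`: the pointwise largest convex
function on `S` that minorizes `f` on `S`. -/
def IsConvexEnvelope {E : Type*} [AddCommMonoid E] [Module ℝ E]
    (S : Set E) (f φ : E → ℝ) : Prop :=
  ConvexOn ℝ S φ ∧ (∀ x ∈ S, φ x ≤ f x) ∧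
    ∀ h : E → ℝ, ConvexOn ℝ S h → (∀ x ∈ S, h x ≤ f x) → ∀ x ∈ S, h x ≤ φ x

/-- `zhat ∈ [ℓ,u]` witnesses the secant-then-function form of the concave
envelope of `σ` on `[ℓ,u]`. -/
def STFEwitness (σ : ℝ → ℝ) (ℓ u zhat : ℝ) : Prop :=
  zhat ∈ Set.Icc ℓ u ∧
    IsConcaveEnvelope (Set.Icc ℓ u) σ
      (fun z => if z < zhat then σ ℓ + (σ zhat - σ ℓ) / (zhat - ℓ) * (z - ℓ) else σ z)

/-- The secant-then-function envelope (STFE) property. -/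
def STFE (σ : ℝ → ℝ) : Prop :=
  ∀ ℓ u : ℝ, ℓ ≤ u → ∃ zhat, STFEwitness σ ℓ u zhat

/-- The tie point of `σ` over `[ℓ,u]`: the smallest STFE witness. -/
def IsTiePoint (σ : ℝ → ℝ) (ℓ u zhat : ℝ) : Prop :=
  STFEwitness σ ℓ u zhat ∧ ∀ z, STFEwitness σ ℓ u z → zhat ≤ z

/-- `σ` is S-shaped: convex then concave. -/
def SShaped (σ : ℝ → ℝ) : Prop :=
  ∃ zt : ℝ, ConvexOn ℝ (Set.Iic zt) σ ∧ ConcaveOn ℝ (Set.Ici zt) σ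

/-- The dot product `wᵀx`. -/
def dotp {n : ℕ} (w x : Fin n → ℝ) : ℝ := ∑ i, w i * x i

/-- The region `R_f` of `[0,1]^n`. Note `‖x‖` is the sup norm on `Fin n → ℝ`. -/
def Rf {n : ℕ} (w : Fin n → ℝ) (b zhat : ℝ) : Set (Fin n → ℝ) :=
  {x | x ∈ Set.Icc (0 : Fin n → ℝ) 1 ∧ zhat ≤ dotp w x + b}

/-- The region `R_l` of `[0,1]^n`. -/
def Rl {n : ℕ} (w : Fin n → ℝ) (b zhat : ℝ) : Set (Fin n → ℝ) :=
  {x | x ∈ Set.Icc (0 : Fin n → ℝ) 1 ∧ dotp w x + b < zhat ∧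
    zhat * ‖x‖ ≤ dotp w x + b * ‖x‖}

/-- The region `R_i` of `[0,1]^n`. -/
def Ri {n : ℕ} (w : Fin n → ℝ) (b zhat : ℝ) (i : Fin n) : Set (Fin n → ℝ) :=
  {x | x ∈ Set.Icc (0 : Fin n → ℝ) 1 ∧ dotp w x + b * ‖x‖ < zhat * ‖x‖ ∧
    (∀ j, j < i → x j < x i) ∧ (∀ j, i ≤ j → x j ≤ x i)}

/-- `D'` is a face of the convex set `D`. -/
def IsFace {E : Type*} [AddCommGroup E] [Module ℝ E] (D D' : Set E) : Prop :=
  D' ⊆ D ∧ Convex ℝ D' ∧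
    ∀ x ∈ D, ∀ y ∈ D, ∀ t : ℝ, 0 < t → t < 1 →
      (1 - t) • x + t • y ∈ D' → x ∈ D' ∧ y ∈ D'


theorem ConcaveOn.mul_add_mul_le {S : Set ℝ} {φ : ℝ → ℝ} (h : ConcaveOn ℝ S φ) {x y z : ℝ}
    (hx : x ∈ S) (hy : y ∈ S) (hxz : x ≤ z) (hzy : z ≤ y) (hxy : x < y) :
    φ x * (y - z) + φ y * (z - x) ≤ φ z * (y - x) := by
  have h0 : 0 < y - x := sub_pos.2 hxy
  have hc := h.2 hx hy (div_nonneg (sub_nonneg.2 hzy) h0.le)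
    (div_nonneg (sub_nonneg.2 hxz) h0.le)
    (by rw [← add_div, div_eq_one_iff_eq h0.ne']; ring)
  have hz : ((y - z) / (y - x)) • x + ((z - x) / (y - x)) • y = z := by
    simp only [smul_eq_mul]; field_simp; ring
  rw [hz] at hc
  have h1 := mul_le_mul_of_nonneg_right hc h0.le
  refine le_trans (le_of_eq ?_) h1
  simp only [smul_eq_mul]
  field_simp

/-- If the concave envelope of `σ` over `[b, c]` is the secant line of slope `s`, then the slope
of the secant from `b` is monotone on `[b, c]`. -/
theorem STFE.mul_le_mul_of_secant {σ : ℝ → ℝ} (hS : STFE σ) (hσ : Continuous σ) {b c s : ℝ}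
    (hb : σ b = 0) (hle : ∀ z ∈ Set.Icc b c, σ z ≤ s * (z - b)) (heq : σ c = s * (c - b))
    {z m : ℝ} (hbz : b ≤ z) (hzm : z ≤ m) (hmc : m ≤ c) :
    σ z * (m - b) ≤ σ m * (z - b) := by
  by_contra! hcon
  have hbz' : b < z := by
    rcases hbz.eq_or_lt with rfl | h
    · simp [hb] at hcon
    · exact h
  have hzm' : z < m := by
    rcases hzm.eq_or_lt with rfl | h
    · simp at hcon
    · exact h
  have hmc' : m < c := by
    rcases hmc.eq_or_lt with rfl | h
    · have := hle z ⟨hbz, hzm⟩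
      rw [heq] at hcon
      nlinarith
    · exact h
  obtain ⟨ρ, hρ1, hρ2⟩ : ∃ ρ, (σ m - σ z) / (m - z) < ρ ∧ ρ < σ z / (z - b) := by
    apply exists_between
    rw [div_lt_div_iff₀ (by linarith) (by linarith)]
    nlinarith
  rw [div_lt_iff₀ (by linarith)] at hρ1
  rw [lt_div_iff₀ (by linarith)] at hρ2
  have hρs : ρ < s := by
    have := hle z ⟨hbz, by linarith⟩
    nlinarith
  obtain ⟨a, ha, hamax⟩ := isCompact_Icc.exists_isMaxOn (⟨z, hbz, hzm⟩ : (Set.Icc b m).Nonempty)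
    (f := fun t => σ t - ρ * t) (by fun_prop)
  have hamax' : ∀ t ∈ Set.Icc b m, σ t - ρ * t ≤ σ a - ρ * a := fun t ht => hamax ht
  have haz := hamax' z ⟨hbz, hzm⟩
  have hba : b < a := by
    rcases ha.1.eq_or_lt with rfl | h
    · nlinarith
    · exact h
  have ham : a < m := by
    rcases ha.2.eq_or_lt with rfl | h
    · nlinarith
    · exact h
  have hac : σ a + ρ * (c - a) < σ c := by
    have := hle a ⟨ha.1, by linarith⟩
    nlinarith
  obtain ⟨u, ⟨⟨hmu, huc⟩, hu⟩, humin⟩ :=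
    (isCompact_Icc.inter_right (isClosed_le (f := fun t => σ a + ρ * (t - a)) (g := σ)
      (by fun_prop) hσ) : IsCompact (Set.Icc m c ∩ _)).exists_isLeast ⟨c, ⟨hmc, le_rfl⟩, hac.le⟩
  have hu' : σ u = σ a + ρ * (u - a) := by
    obtain ⟨t, ht, ht0⟩ := intermediate_value_Icc hmu
      (f := fun t => σ t - (σ a + ρ * (t - a))) (by fun_prop)
      (show (0 : ℝ) ∈ _ from ⟨by nlinarith, by simpa using hu⟩)
    simp only at ht0
    have hut : u ≤ t := humin ⟨⟨ht.1, ht.2.trans huc⟩, show σ a + ρ * (t - a) ≤ σ t by linarith⟩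
    obtain rfl : t = u := le_antisymm ht.2 hut
    linarith
  have hmu' : m < u := by
    rcases hmu.eq_or_lt with rfl | h
    · nlinarith
    · exact h
  obtain ⟨t, -, hconc, hmaj, hmin⟩ := hS b u (by linarith)
  have haff : ConcaveOn ℝ (Set.Icc b u) fun t => σ a + ρ * (t - a) := by
    refine ⟨convex_Icc _ _, fun x _ y _ α β _ _ h => ?_⟩
    simp only [smul_eq_mul]
    obtain rfl : β = 1 - α := by linarith
    nlinarith
  have hup := hmin _ haff (fun x hx => by
    rcases le_or_gt x m with h | h
    · linarith [hamax' x ⟨hx.1, h⟩]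
    · by_contra! hlt
      have := humin ⟨⟨h.le, hx.2.trans huc⟩, hlt.le⟩
      obtain rfl : x = u := le_antisymm hx.2 this
      linarith) m ⟨by linarith, hmu⟩
  have hla := hmaj a ⟨ha.1, by linarith⟩
  have hlu := hmaj u ⟨by linarith, le_rfl⟩
  have hmcomb := hconc.mul_add_mul_le (x := a) (y := u) (z := m) ⟨ha.1, by linarith⟩
    ⟨by linarith, le_rfl⟩ ham.le hmu (by linarith)
  set φ : ℝ → ℝ := fun z => if z < t then σ b + (σ t - σ b) / (t - b) * (z - b) else σ z with hφ
  have hlow : σ a + ρ * (m - a) ≤ φ m := by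
    have h1 := mul_le_mul_of_nonneg_right hla (sub_nonneg.2 hmu)
    have h2 := mul_le_mul_of_nonneg_right hlu (sub_nonneg.2 ham.le)
    rw [hu'] at h2
    refine le_of_mul_le_mul_right ?_ (by linarith : 0 < u - a)
    refine le_trans ?_ hmcomb
    refine le_trans (le_of_eq ?_) (add_le_add h1 h2)
    ring
  have hσm := hamax' m ⟨by linarith, le_rfl⟩
  have hmt : m < t := by
    by_contra! h
    have hm1 : φ m = σ m := by simp [hφ, not_lt.2 h]
    nlinarith
  have hφm : φ m = (σ t - σ b) / (t - b) * (m - b) := by simp [hφ, hmt, hb]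
  have hφa : φ a = (σ t - σ b) / (t - b) * (a - b) := by simp [hφ, ham.trans hmt, hb]
  change σ a ≤ φ a at hla
  change φ m ≤ _ at hup
  rw [hφm] at hup
  rw [hφa] at hla
  set μ := (σ t - σ b) / (t - b)
  have hab := hamax' b ⟨le_rfl, by linarith⟩
  have hρμ : ρ < μ := by nlinarith
  nlinarith

/-- A continuous concave majorant `T` agreeing with the envelope at `p` touches the function
somewhere in every closed superlevel set `{0 ≤ l}` of a convex `l` with `0 < l p`. -/
theorem IsConcaveEnvelope.exists_eq_of_convexOn {E : Type*} [AddCommGroup E] [Module ℝ E]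
    [TopologicalSpace E] {S : Set E} (hS : IsCompact S) {F φ T l : E → ℝ}
    (hφ : IsConcaveEnvelope S F φ) (hF : ContinuousOn F S) (hT : ConcaveOn ℝ S T)
    (hTc : ContinuousOn T S) (hFT : ∀ q ∈ S, F q ≤ T q) (hl : ConvexOn ℝ S l)
    (hlc : Continuous l) {p : E} (hp : p ∈ S) (hTp : T p ≤ φ p) (hlp : 0 < l p) :
    ∃ q ∈ S, 0 ≤ l q ∧ F q = T q := by
  obtain ⟨q, ⟨hqS, hql⟩, hq⟩ := (hS.inter_right (isClosed_le continuous_const hlc)).exists_isMinOn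
    ⟨p, hp, hlp.le⟩ (f := fun q => T q - F q)
    ((hTc.sub hF).mono Set.inter_subset_left)
  refine ⟨q, hqS, hql, ?_⟩
  by_contra hne
  have hη : 0 < T q - F q := sub_pos.2 (lt_of_le_of_ne (hFT q hqS) hne)
  obtain ⟨r, hr, hrmax⟩ := hS.exists_isMaxOn ⟨p, hp⟩ hlc.continuousOn
  have hlr : ∀ x ∈ S, l x ≤ l r := fun x hx => hrmax hx
  have hr0 : 0 < l r := hlp.trans_le (hlr p hp)
  set ε := (T q - F q) / l r with hε
  have hε0 : 0 < ε := div_pos hη hr0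
  have hεr : ε * l r = T q - F q := div_mul_cancel₀ _ hr0.ne'
  have := hφ.2.2 (T - ε • l) (hT.sub (hl.smul hε0.le)) (fun x hx => by
    simp only [Pi.sub_apply, Pi.smul_apply, smul_eq_mul]
    rcases le_or_gt 0 (l x) with h | h
    · have h1 : T q - F q ≤ T x - F x := hq ⟨hx, h⟩
      have h2 := mul_le_mul_of_nonneg_left (hlr x hx) hε0.le
      linarith
    · nlinarith [hFT x hx]) p hp
  simp only [Pi.sub_apply, Pi.smul_apply, smul_eq_mul] at this
  nlinarith

theorem dotp_add {n : ℕ} (w x y : Fin n → ℝ) : dotp w (x + y) = dotp w x + dotp w y :=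
  dotProduct_add w x y

theorem dotp_smul {n : ℕ} (w x : Fin n → ℝ) (t : ℝ) : dotp w (t • x) = t * dotp w x :=
  dotProduct_smul t w x

theorem dotp_single {n : ℕ} (w : Fin n → ℝ) (j : Fin n) (t : ℝ) :
    dotp w (Pi.single j t) = w j * t :=
  dotProduct_single w t j

theorem dotp_nonneg {n : ℕ} {w x : Fin n → ℝ} (hw : 0 ≤ w) (hx : 0 ≤ x) : 0 ≤ dotp w x :=
  Finset.sum_nonneg fun i _ => mul_nonneg (hw i) (hx i)

@[fun_prop]
theorem continuous_dotp {n : ℕ} (w : Fin n → ℝ) : Continuous (dotp w) := by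
  unfold dotp
  fun_prop

theorem concaveOn_const_add_dotp {n : ℕ} {S : Set (Fin n → ℝ)} (hS : Convex ℝ S) (a : ℝ)
    (c : Fin n → ℝ) : ConcaveOn ℝ S fun q => a + dotp c q := by
  refine ⟨hS, fun x _ y _ α β _ _ h => ?_⟩
  simp only [smul_eq_mul, dotp_add, dotp_smul]
  obtain rfl : β = 1 - α := by linarith
  nlinarith

/-- The data of a tangent hyperplane `q ↦ a + c ⬝ q` on the face of the cube where one coordinate,
of weight `ω`, is fixed to `1`: it majorizes `σ`, and it lies below the secant line at a point `p`
of the face whose level is below the tie point. -/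
structure FaceTangent {n : ℕ} (σ : ℝ → ℝ) (b zhat s ω : ℝ) (w : Fin n → ℝ) (a : ℝ)
    (c p : Fin n → ℝ) : Prop where
  cont : Continuous σ
  stfe : STFE σ
  map_b : σ b = 0
  ω_pos : 0 < ω
  w_pos : ∀ j, 0 < w j
  secant : ∀ z, b ≤ z → z ≤ dotp w 1 + ω + b → σ z ≤ s * (z - b)
  map_tie : σ zhat = s * (zhat - b)
  majorizes : ∀ q ∈ Set.Icc (0 : Fin n → ℝ) 1, σ (dotp w q + ω + b) ≤ a + dotp c q
  mem : p ∈ Set.Icc (0 : Fin n → ℝ) 1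
  lt_tie : dotp w p + ω + b < zhat
  tie_le : zhat ≤ dotp w 1 + ω + b
  le_secant : a + dotp c p ≤ s * (dotp w p + ω)

namespace FaceTangent

variable {n : ℕ} {σ : ℝ → ℝ} {b zhat s ω a : ℝ} {w c p : Fin n → ℝ}

theorem slope_mono (H : FaceTangent σ b zhat s ω w a c p) {z m : ℝ} (hbz : b ≤ z) (hzm : z ≤ m)
    (hm : m ≤ zhat) : σ z * (m - b) ≤ σ m * (z - b) :=
  H.stfe.mul_le_mul_of_secant H.cont H.map_b
    (fun z hz => H.secant z hz.1 (hz.2.trans H.tie_le)) H.map_tie hbz hzm hm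

theorem dotp_w_nonneg (H : FaceTangent σ b zhat s ω w a c p) {q : Fin n → ℝ} (hq : 0 ≤ q) :
    0 ≤ dotp w q :=
  dotp_nonneg (fun j => (H.w_pos j).le) hq

/-- Above the tie point the tangent hyperplane dominates the secant line. -/
theorem secant_le (H : FaceTangent σ b zhat s ω w a c p) {q : Fin n → ℝ}
    (hq : q ∈ Set.Icc (0 : Fin n → ℝ) 1) (hz : zhat ≤ dotp w q + ω + b) :
    s * (dotp w q + ω) ≤ a + dotp c q := by
  have hlt := H.lt_tie
  have hd : 0 < dotp w q - dotp w p := by linarith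
  set t := (zhat - (dotp w p + ω + b)) / (dotp w q - dotp w p) with ht
  have ht0 : 0 < t := div_pos (by linarith) hd
  have ht1 : t ≤ 1 := (div_le_one hd).2 (by linarith)
  have htd : t * (dotp w q - dotp w p) = zhat - (dotp w p + ω + b) := div_mul_cancel₀ _ hd.ne'
  have hr := H.majorizes ((1 - t) • p + t • q)
    ((convex_Icc _ _) H.mem hq (by linarith) ht0.le (by ring))
  simp only [dotp_add, dotp_smul] at hr
  rw [show (1 - t) * dotp w p + t * dotp w q + ω + b = zhat by linarith, H.map_tie] at hr
  have hp := H.le_secant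
  have : t * (s * (dotp w q + ω)) ≤ t * (a + dotp c q) := by
    have h1 := mul_le_mul_of_nonneg_left hp (by linarith : (0 : ℝ) ≤ 1 - t)
    have h2 : s * (zhat - b) = s * ((1 - t) * dotp w p + t * dotp w q + ω) := by
      congr 1; linarith
    nlinarith
  exact le_of_mul_le_mul_left this ht0

/-- The fixed coordinate has the smallest slope: the case of a free coordinate `j` of smallest
slope, given a contact point `q` with `q j < 1`. -/
theorem slope_le_of_contact (H : FaceTangent σ b zhat s ω w a c p) {j : Fin n}
    (hj : ∀ k, c j * w k ≤ c k * w j) {q : Fin n → ℝ} (hq : q ∈ Set.Icc (0 : Fin n → ℝ) 1)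
    (hqj : q j < 1) (hqt : σ (dotp w q + ω + b) = a + dotp c q) : a * w j ≤ c j * ω := by
  have hwj := H.w_pos j
  have hω := H.ω_pos
  have hcw : ∀ r : Fin n → ℝ, 0 ≤ r → c j * dotp w r ≤ dotp c r * w j := fun r hr => by
    simp only [dotp, Finset.mul_sum, Finset.sum_mul]
    refine Finset.sum_le_sum fun k _ => ?_
    have := mul_le_mul_of_nonneg_right (hj k) (hr k)
    linarith
  have hwq := H.dotp_w_nonneg hq.1
  rcases lt_or_ge (dotp w q + ω + b) zhat with hZ | hZ
  · set ε := min (1 - q j) ((zhat - (dotp w q + ω + b)) / w j) with hε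
    have hε0 : 0 < ε := lt_min (by linarith) (div_pos (by linarith) hwj)
    have hε1 : ε ≤ 1 - q j := min_le_left _ _
    have hε2 : w j * ε ≤ zhat - (dotp w q + ω + b) := by
      have : ε ≤ _ := min_le_right _ _
      rwa [le_div_iff₀ hwj, mul_comm] at this
    have hr := H.majorizes (q + Pi.single j ε) ⟨fun k => by
      rcases eq_or_ne k j with rfl | h
      · have := hq.1 k
        simp at this ⊢; linarith
      · simpa [h] using hq.1 k, fun k => by
      rcases eq_or_ne k j with rfl | h
      · simp; linarith
      · simpa [h] using hq.2 k⟩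
    simp only [dotp_add, dotp_single] at hr
    have hs := H.slope_mono (z := dotp w q + ω + b) (m := dotp w q + w j * ε + ω + b)
      (by linarith) (by nlinarith) (by linarith)
    have h1 : (a + dotp c q) * w j ≤ c j * (dotp w q + ω) := by
      rw [hqt] at hs
      have h2 := mul_le_mul_of_nonneg_right hr (by linarith : 0 ≤ dotp w q + ω)
      have h3 : ε * ((a + dotp c q) * w j) ≤ ε * (c j * (dotp w q + ω)) := by
        ring_nf at hs h2 ⊢; linarith
      exact le_of_mul_le_mul_left h3 hε0
    have := hcw q hq.1
    linarith
  · have hgreedy : ∀ k, 0 < q k → c k * w j ≤ c j * w k := fun k hk => by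
      rcases eq_or_ne k j with rfl | hkj
      · exact le_rfl
      have hwk := H.w_pos k
      set ε := min ((1 - q j) / w k) (q k / w j) with hε
      have hε0 : 0 < ε := lt_min (div_pos (by linarith) hwk) (div_pos hk hwj)
      have hε1 : ε * w k ≤ 1 - q j := (le_div_iff₀ hwk).1 (min_le_left _ _)
      have hε2 : ε * w j ≤ q k := (le_div_iff₀ hwj).1 (min_le_right _ _)
      have hr := H.majorizes (q + Pi.single j (ε * w k) + Pi.single k (-(ε * w j)))
        ⟨fun l => by
          have h0 := hq.1 l
          have hεk : 0 < ε * w k := mul_pos hε0 hwk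
          rcases eq_or_ne l j with rfl | h
          · simp [hkj.symm] at h0 ⊢; linarith
          · rcases eq_or_ne l k with rfl | h'
            · simp [h] at h0 ⊢; linarith
            · simpa [h, h'] using h0, fun l => by
          have h0 := hq.2 l
          have hεj : 0 < ε * w j := mul_pos hε0 hwj
          rcases eq_or_ne l j with rfl | h
          · simp [hkj.symm] at h0 ⊢; linarith
          · rcases eq_or_ne l k with rfl | h'
            · simp [h] at h0 ⊢; linarith
            · simpa [h, h'] using h0⟩
      simp only [dotp_add, dotp_single] at hr
      rw [show dotp w q + w j * (ε * w k) + w k * -(ε * w j) + ω + b = dotp w q + ω + b by ring,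
        hqt] at hr
      have : ε * (c k * w j) ≤ ε * (c j * w k) := by linarith
      exact le_of_mul_le_mul_left this hε0
    have hcq : dotp c q * w j = c j * dotp w q := by
      simp only [dotp, Finset.mul_sum, Finset.sum_mul]
      refine Finset.sum_congr rfl fun k _ => ?_
      rcases (hq.1 k).eq_or_lt with h | h
      · simp [← h]
      · have := (hj k).antisymm (hgreedy k h)
        linear_combination -(q k) * this
    by_contra! hcon
    have hlt := H.lt_tie
    have hwp := H.dotp_w_nonneg H.mem.1
    have hwq0 : 0 < dotp w q := by linarith
    set t := (zhat - ω - b) / dotp w q with ht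
    have ht0 : 0 ≤ t := div_nonneg (by linarith) hwq0.le
    have ht1 : t ≤ 1 := (div_le_one hwq0).2 (by linarith)
    have htd : t * dotp w q = zhat - ω - b := div_mul_cancel₀ _ hwq0.ne'
    have hmem : t • q ∈ Set.Icc (0 : Fin n → ℝ) 1 :=
      ⟨smul_nonneg ht0 hq.1, fun k => by
        have h0 := hq.1 k
        have h1 := hq.2 k
        simp only [Pi.zero_apply, Pi.one_apply, Pi.smul_apply, smul_eq_mul] at *
        nlinarith⟩
    have hr := H.majorizes _ hmem
    simp only [dotp_smul] at hr
    rw [show t * dotp w q + ω + b = zhat by linarith, H.map_tie] at hr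
    have hσq := H.secant (dotp w q + ω + b) (by linarith) (by
      have h1 := H.dotp_w_nonneg (sub_nonneg.2 hq.2)
      have h2 : dotp w 1 = dotp w (1 - q) + dotp w q := by rw [← dotp_add]; simp
      linarith)
    rw [hqt] at hσq
    have hp := mul_le_mul_of_nonneg_right H.le_secant hwj.le
    have hcp := hcw p H.mem.1
    have hr' := mul_le_mul_of_nonneg_right hr hwj.le
    have hline : ∀ v, (a * w j + c j * v) - s * (v + ω) * w j =
        (a * w j - c j * ω) + (c j - s * w j) * (v + ω) := fun v => by ring
    have h1 : 0 ≤ (a * w j - c j * ω) + (c j - s * w j) * (zhat - b) := by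
      have := hline (zhat - ω - b)
      rw [← htd, mul_left_comm, ← hcq] at this
      rw [htd] at this
      ring_nf at this hr' ⊢
      linarith
    have h2 : (a * w j - c j * ω) + (c j - s * w j) * (dotp w p + ω) ≤ 0 := by
      have := hline (dotp w p)
      nlinarith
    have h3 : 0 < c j - s * w j := by nlinarith
    nlinarith

/-- The fixed coordinate has the smallest slope. -/
theorem slope_le (H : FaceTangent σ b zhat s ω w a c p) {φ : (Fin n → ℝ) → ℝ}
    (hφ : IsConcaveEnvelope (Set.Icc 0 1) (fun q => σ (dotp w q + ω + b)) φ)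
    (hφp : φ p = a + dotp c p) (hp : ∀ j, p j < 1) (k : Fin n) : a * w k ≤ c k * ω := by
  have : Nonempty (Fin n) := ⟨k⟩
  obtain ⟨j, hj⟩ := Finite.exists_min fun j => c j / w j
  have hj' : ∀ k, c j * w k ≤ c k * w j := fun k =>
    (div_le_div_iff₀ (H.w_pos j) (H.w_pos k)).1 (hj k)
  have hpj := hp j
  have hcont := H.cont
  obtain ⟨q, hq, hlq, hqt⟩ := hφ.exists_eq_of_convexOn isCompact_Icc
    (T := fun q => a + dotp c q) (l := fun q => (1 + p j) / 2 - q j)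
    (by fun_prop) (concaveOn_const_add_dotp (convex_Icc _ _) _ _) (by fun_prop) H.majorizes
    ⟨convex_Icc _ _, fun x _ y _ α β _ _ h => by
      simp only [Pi.add_apply, Pi.smul_apply, smul_eq_mul]
      obtain rfl : β = 1 - α := by linarith
      nlinarith⟩ (by fun_prop) H.mem hφp.ge (by linarith)
  have h1 := H.slope_le_of_contact hj' hq (by linarith) hqt
  have hwj := H.w_pos j
  have h2 := mul_le_mul_of_nonneg_right h1 (H.w_pos k).le
  have h3 := mul_le_mul_of_nonneg_right (hj' k) H.ω_pos.le
  exact le_of_mul_le_mul_right (by linarith : a * w k * w j ≤ c k * ω * w j) hwj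

/-- The homogeneous extension of the tangent hyperplane majorizes `σ` below the tie point. -/
theorem le_homogeneous (H : FaceTangent σ b zhat s ω w a c p)
    (hslope : ∀ k, a * w k ≤ c k * ω) {ξ M : ℝ} {x : Fin n → ℝ} (hξ : 0 ≤ ξ) (hx : 0 ≤ x)
    (hM0 : 0 < M) (hM1 : M ≤ 1) (hξM : ξ ≤ M) (hxM : ∀ j, x j ≤ M)
    (hlt : ω * ξ + dotp w x + b < zhat) :
    σ (ω * ξ + dotp w x + b) ≤ a * ξ + dotp c x := by
  have hω := H.ω_pos
  have hq : M⁻¹ • x ∈ Set.Icc (0 : Fin n → ℝ) 1 :=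
    ⟨smul_nonneg (inv_nonneg.2 hM0.le) hx, fun j => by
      simpa [inv_mul_le_iff₀ hM0] using hxM j⟩
  have hdx : dotp w x = M * dotp w (M⁻¹ • x) := by rw [dotp_smul]; field_simp
  have hcx : dotp c x = M * dotp c (M⁻¹ • x) := by rw [dotp_smul]; field_simp
  have hmaj := H.majorizes _ hq
  have hsec := H.secant_le hq
  have hQ := H.dotp_w_nonneg hq.1
  have hκ : a * dotp w (M⁻¹ • x) ≤ dotp c (M⁻¹ • x) * ω := by
    simp only [dotp, Finset.mul_sum, Finset.sum_mul]
    refine Finset.sum_le_sum fun k _ => ?_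
    have := mul_le_mul_of_nonneg_right (hslope k) (hq.1 k)
    linarith
  rw [hdx] at hlt ⊢
  rw [hcx]
  set Q := dotp w (M⁻¹ • x)
  set C := dotp c (M⁻¹ • x)
  have hZ : 0 < Q + ω := by linarith
  set t := (ω * ξ + M * Q) / (Q + ω) with ht
  have htZ : t * (Q + ω) = ω * ξ + M * Q := div_mul_cancel₀ _ hZ.ne'
  have ht0 : 0 ≤ t := div_nonneg (by positivity) hZ.le
  have htM : t ≤ M := (div_le_iff₀ hZ).2 (by nlinarith)
  have hT : t * (a + C) ≤ a * ξ + M * C := by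
    have h1 := mul_le_mul_of_nonneg_left hκ (sub_nonneg.2 htM)
    have h2 : ω * (t * (a + C)) ≤ ω * (a * ξ + M * C) := by
      linear_combination h1 + a * htZ
    exact le_of_mul_le_mul_left h2 hω
  refine le_trans ?_ hT
  have hv : 0 ≤ ω * ξ + M * Q := by positivity
  rcases le_or_gt (Q + ω + b) zhat with h | h
  · have h1 := H.slope_mono (z := ω * ξ + M * Q + b) (m := Q + ω + b) (by linarith)
      (by nlinarith) h
    have h2 := mul_le_mul_of_nonneg_right hmaj hv
    have h3 : σ (ω * ξ + M * Q + b) * (Q + ω) ≤ t * (a + C) * (Q + ω) := by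
      have : t * (a + C) * (Q + ω) = (a + C) * (ω * ξ + M * Q) := by rw [← htZ]; ring
      rw [this]
      ring_nf at h1 h2 ⊢
      linarith
    exact le_of_mul_le_mul_right h3 hZ
  · have h1 := H.secant (ω * ξ + M * Q + b) (by linarith) (hlt.le.trans H.tie_le)
    have h2 := mul_le_mul_of_nonneg_left (hsec h.le) ht0
    have h3 : t * (s * (Q + ω)) = s * (ω * ξ + M * Q) := by rw [← htZ]; ring
    rw [h3] at h2
    linarith

end FaceTangent

/-- The secant slope of an STFE witness to the right of `ℓ` majorizes on the whole interval. -/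
theorem STFEwitness.le_secant {σ : ℝ → ℝ} {ℓ u t : ℝ} (h : STFEwitness σ ℓ u t) (hℓ : ℓ < t)
    (hσ : σ ℓ = 0) {z : ℝ} (hz : z ∈ Set.Icc ℓ u) : σ z ≤ σ t / (t - ℓ) * (z - ℓ) := by
  obtain ⟨⟨-, htu⟩, hconc, hmaj, -⟩ := h
  rcases lt_or_ge z t with hzt | htz
  · simpa [hzt, hσ] using hmaj z hz
  · have hc := hconc.mul_add_mul_le (x := ℓ) (y := z) (z := t) ⟨le_rfl, by linarith⟩ hz hℓ.le htz
      (by linarith)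
    simp only [hℓ, if_true, hσ, not_lt.2 htz, lt_irrefl, if_false] at hc
    rw [div_mul_eq_mul_div, le_div_iff₀ (by linarith)]
    linarith

theorem HasDerivAt.le_of_eventually_ge {φ : ℝ → ℝ} {D k : ℝ} (h : HasDerivAt φ D 0)
    (hk : ∀ᶠ t in nhdsWithin 0 (Set.Ioi 0), φ 0 + t * k ≤ φ t) : k ≤ D := by
  have h1 : Filter.Tendsto (slope φ 0) (nhdsWithin 0 (Set.Ioi 0)) (nhds D) :=
    (hasDerivAt_iff_tendsto_slope.1 h).mono_left
      (nhdsWithin_mono 0 fun t (ht : 0 < t) => ht.ne')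
  refine ge_of_tendsto h1 ?_
  filter_upwards [hk, self_mem_nhdsWithin] with t ht ht0
  have ht0' : (0 : ℝ) < t := ht0
  rw [slope_def_field, sub_zero, le_div_iff₀ ht0']
  linarith

theorem ContinuousLinearMap.apply_eq_dotp {n : ℕ} (D : (Fin n → ℝ) →L[ℝ] ℝ) (x : Fin n → ℝ) :
    D x = dotp (fun k => D (Pi.single k 1)) x := by
  conv_lhs => rw [← Finset.univ_sum_single x, map_sum]
  refine Finset.sum_congr rfl fun k _ => ?_
  rw [show Pi.single k (x k) = x k • (Pi.single k 1 : Fin n → ℝ) by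
    rw [← Pi.single_smul, smul_eq_mul, mul_one], map_smul, smul_eq_mul, mul_comm]

theorem dotp_succAbove {n : ℕ} (i : Fin (n + 1)) (w x : Fin (n + 1) → ℝ) :
    dotp w x = w i * x i + dotp (fun j => w (i.succAbove j)) fun j => x (i.succAbove j) :=
  Fin.sum_univ_succAbove _ i

theorem norm_eq_of_mem_Ri {n : ℕ} {w : Fin n → ℝ} {b zhat : ℝ} {i : Fin n} {y : Fin n → ℝ}
    (hy : y ∈ Ri w b zhat i) : ‖y‖ = y i := by
  obtain ⟨⟨h0, -⟩, -, h1, h2⟩ := hy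
  refine le_antisymm ((pi_norm_le_iff_of_nonneg (h0 i)).2 fun j => ?_)
    ((Real.le_norm_self _).trans (norm_le_pi_norm y i))
  rw [Real.norm_of_nonneg (h0 j)]
  exact (lt_or_ge j i).elim (fun h => (h1 j h).le) (h2 j)

theorem le_apply_of_mem_Ri {n : ℕ} {w : Fin n → ℝ} {b zhat : ℝ} {i : Fin n} {y : Fin n → ℝ}
    (hy : y ∈ Ri w b zhat i) (j : Fin n) : y j ≤ y i :=
  (lt_or_ge j i).elim (fun h => (hy.2.2.1 j h).le) (hy.2.2.2 j)

theorem eventually_add_smul_mem_of_mem_interior {E : Type*} [AddCommGroup E] [Module ℝ E]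
    [TopologicalSpace E] [ContinuousAdd E] [ContinuousSMul ℝ E] {S : Set E} {y : E}
    (hy : y ∈ interior S) (v : E) : ∀ᶠ t in nhds (0 : ℝ), y + t • v ∈ S := by
  have hc : Continuous fun t : ℝ => y + t • v := by fun_prop
  exact hc.continuousAt.eventually_mem (by simpa using mem_interior_iff_mem_nhds.1 hy)

theorem apply_pos_of_mem_interior_Ri {n : ℕ} {w : Fin n → ℝ} {b zhat : ℝ} {i : Fin n}
    {y : Fin n → ℝ} (hy : y ∈ interior (Ri w b zhat i)) : 0 < y i := by
  obtain ⟨t, ht, ht0⟩ := (((eventually_add_smul_mem_of_mem_interior hy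
    (Pi.single i (-1))).filter_mono nhdsWithin_le_nhds).and
    (self_mem_nhdsWithin (s := Set.Ioi (0 : ℝ)))).exists
  have h0 := ht.1.1 i
  have ht0' : (0 : ℝ) < t := ht0
  simp at h0
  linarith

theorem apply_lt_of_mem_interior_Ri {n : ℕ} {w : Fin n → ℝ} {b zhat : ℝ} {i : Fin n}
    {y : Fin n → ℝ} (hy : y ∈ interior (Ri w b zhat i)) {j : Fin n} (hj : j ≠ i) :
    y j < y i := by
  obtain ⟨t, ht, ht0⟩ := (((eventually_add_smul_mem_of_mem_interior hy
    (Pi.single j 1)).filter_mono nhdsWithin_le_nhds).and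
    (self_mem_nhdsWithin (s := Set.Ioi (0 : ℝ)))).exists
  have h0 := le_apply_of_mem_Ri ht j
  have ht0' : (0 : ℝ) < t := ht0
  simp [hj.symm] at h0
  linarith

theorem stmt16 {n : ℕ} (w : Fin (n+1) → ℝ) (hw : ∀ i, 0 < w i) (b : ℝ)
    (σ : ℝ → ℝ) (hσ : Continuous σ) (hSTFE : STFE σ) (hb : σ b = 0)
    (zhat : ℝ) (htie : IsTiePoint σ b ((∑ i, w i) + b) zhat)
    (ψ : Fin (n+1) → (Fin n → ℝ) → ℝ)
    (hψ : ∀ i, IsConcaveEnvelope (Set.Icc 0 1)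
      (fun y : Fin n → ℝ => σ ((∑ j, w (i.succAbove j) * y j) + w i + b)) (ψ i))
    (g : (Fin (n+1) → ℝ) → ℝ)
    (hgf : ∀ x ∈ Rf w b zhat, g x = σ (dotp w x + b))
    (hgl : ∀ x ∈ Rl w b zhat, g x = σ zhat / (zhat - b) * dotp w x)
    (hgi : ∀ i : Fin (n+1), ∀ x ∈ Ri w b zhat i,
      g x = x i * ψ i (fun j => x (i.succAbove j) / x i))
    (i : Fin (n+1)) (y : Fin (n+1) → ℝ) (hy : y ∈ interior (Ri w b zhat i))
    (hdiff : DifferentiableAt ℝ (ψ i) (fun j => y (i.succAbove j) / y i))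
    (Dg : (Fin (n+1) → ℝ) →L[ℝ] ℝ) (hDg : HasFDerivAt g Dg y) :
    ∀ x : Fin (n+1) → ℝ, (∀ j, x j ∈ Set.Ioo (0 : ℝ) 1) →
      x ∉ Ri w b zhat i ∪ Rf w b zhat →
      σ (dotp w x + b) ≤ g y + Dg (x - y) := by
  intro x hx hxnot
  have hyR := interior_subset hy
  have hyi := apply_pos_of_mem_interior_Ri hy
  have hyj : ∀ j, y (i.succAbove j) < y i := fun j =>
    apply_lt_of_mem_interior_Ri hy (i.succAbove_ne j)
  set p : Fin n → ℝ := fun j => y (i.succAbove j) / y i with hp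
  set w' : Fin n → ℝ := fun j => w (i.succAbove j) with hw'
  set a := Dg (Pi.single i 1) with ha
  set c : Fin n → ℝ := fun j => Dg (Pi.single (i.succAbove j) 1) with hc
  have hDgx : ∀ x, Dg x = a * x i + dotp c fun j => x (i.succAbove j) := fun x => by
    rw [Dg.apply_eq_dotp, dotp_succAbove i]
  have hψ' : IsConcaveEnvelope (Set.Icc 0 1) (fun q => σ (dotp w' q + w i + b)) (ψ i) := hψ i
  have hW : (∑ k, w k) + b = dotp w' 1 + w i + b := by
    rw [Fin.sum_univ_succAbove _ i]
    simp [dotp, hw']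
    ring
  rw [hW] at htie
  have hpmem : p ∈ Set.Icc (0 : Fin n → ℝ) 1 :=
    ⟨fun j => div_nonneg (hyR.1.1 _) hyi.le, fun j => (div_le_one hyi).2 (hyj j).le⟩
  have hp1 : ∀ j, p j < 1 := fun j => (div_lt_one hyi).2 (hyj j)
  have hyp : (fun j => y (i.succAbove j)) = y i • p := by
    ext j
    simp only [hp, Pi.smul_apply, smul_eq_mul]
    field_simp
  have hplt : dotp w' p + w i + b < zhat := by
    have h := hyR.2.1
    rw [norm_eq_of_mem_Ri hyR, dotp_succAbove i, hyp, dotp_smul] at h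
    nlinarith
  have hwp : 0 ≤ dotp w' p := dotp_nonneg (fun j => (hw _).le) hpmem.1
  have hbz : b < zhat := by linarith [hw i]
  have hgy : g y = y i * ψ i p := hgi i y hyR
  have hDy : Dg y = g y := by
    have h1 : HasDerivAt (fun t : ℝ => g (y + t • y)) (Dg y) 0 := by
      have h2 : HasDerivAt (fun t : ℝ => y + t • y) y 0 := by
        simpa using ((hasDerivAt_id (0 : ℝ)).smul_const y).const_add y
      exact HasFDerivAt.comp_hasDerivAt (0 : ℝ) (by simpa using hDg) h2
    have h2 : HasDerivAt (fun t : ℝ => (1 + t) * g y) (g y) 0 := by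
      simpa using ((hasDerivAt_id (0 : ℝ)).const_add 1).mul_const (g y)
    refine h1.unique (h2.congr_of_eventuallyEq ?_)
    filter_upwards [eventually_add_smul_mem_of_mem_interior hy y,
      Ioi_mem_nhds (by norm_num : (-1 : ℝ) < 0)] with t ht ht1
    have ht1' : 0 < 1 + t := by linarith [Set.mem_Ioi.1 ht1]
    rw [hgi i _ ht, hgy, show (fun j => (y + t • y) (i.succAbove j) / (y + t • y) i) = p by
      ext j
      simp only [Pi.add_apply, Pi.smul_apply, smul_eq_mul, hp]
      rw [← one_add_mul, ← one_add_mul, mul_div_mul_left _ _ ht1'.ne']]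
    simp only [Pi.add_apply, Pi.smul_apply, smul_eq_mul]
    ring
  have hTp : ψ i p = a + dotp c p := by
    have h := hDgx y
    rw [hDy, hgy, hyp, dotp_smul] at h
    exact mul_left_cancel₀ hyi.ne' (by linarith)
  have hTq : ∀ q ∈ Set.Icc (0 : Fin n → ℝ) 1, ψ i q ≤ a + dotp c q := fun q hq => by
    set v : Fin (n + 1) → ℝ := i.insertNth 0 (y i • (q - p)) with hv
    have h1 : HasDerivAt (fun t : ℝ => g (y + t • v)) (Dg v) 0 := by
      have h2 : HasDerivAt (fun t : ℝ => y + t • v) v 0 := by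
        simpa using ((hasDerivAt_id (0 : ℝ)).smul_const v).const_add y
      exact HasFDerivAt.comp_hasDerivAt (0 : ℝ) (by simpa using hDg) h2
    have h3 := h1.le_of_eventually_ge (k := y i * (ψ i q - ψ i p)) (by
      filter_upwards [(eventually_add_smul_mem_of_mem_interior hy v).filter_mono
        nhdsWithin_le_nhds, self_mem_nhdsWithin,
        nhdsWithin_le_nhds (Iio_mem_nhds (zero_lt_one' ℝ))] with t ht ht0 ht1
      have ht0' : (0 : ℝ) < t := ht0
      have ht1' : t < 1 := ht1
      rw [zero_smul, add_zero, hgi i _ ht, hgy,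
        show (fun j => (y + t • v) (i.succAbove j) / (y + t • v) i) = (1 - t) • p + t • q by
          ext j
          simp only [Pi.add_apply, Pi.smul_apply, smul_eq_mul, hv, Fin.insertNth_apply_same,
            Fin.insertNth_apply_succAbove, Pi.sub_apply, hp]
          field_simp
          ring]
      have h4 := hψ'.1.2 hpmem hq (by linarith : 0 ≤ 1 - t) ht0'.le (by ring)
      simp only [smul_eq_mul] at h4
      have h5 : (y + t • v) i = y i := by simp [hv]
      rw [h5]
      have := mul_le_mul_of_nonneg_left h4 hyi.le
      linarith)
    have h4 : Dg v = y i * (dotp c q - dotp c p) := by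
      rw [hDgx]
      have : dotp c (q - p) = dotp c q - dotp c p := dotProduct_sub c q p
      rw [show (fun j => v (i.succAbove j)) = y i • (q - p) by ext j; simp [hv],
        show v i = 0 by simp [hv], dotp_smul, this, mul_zero, zero_add]
    rw [h4] at h3
    have := le_of_mul_le_mul_left h3 hyi
    linarith
  have hsec : ∀ z, b ≤ z → z ≤ dotp w' 1 + w i + b → σ z ≤ σ zhat / (zhat - b) * (z - b) :=
    fun z h1 h2 => htie.1.le_secant hbz hb ⟨h1, h2⟩
  have H : FaceTangent σ b zhat (σ zhat / (zhat - b)) (w i) w' a c p :=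
    { cont := hσ
      stfe := hSTFE
      map_b := hb
      ω_pos := hw i
      w_pos := fun j => hw _
      secant := hsec
      map_tie := (div_mul_cancel₀ _ (by linarith)).symm
      majorizes := fun q hq => (hψ'.2.1 q hq).trans (hTq q hq)
      mem := hpmem
      lt_tie := hplt
      tie_le := htie.1.1.2
      le_secant := by
        rw [← hTp]
        set s := σ zhat / (zhat - b)
        have hcon : ConcaveOn ℝ (Set.Icc (0 : Fin n → ℝ) 1)
            fun q => s * w i + dotp (s • w') q := concaveOn_const_add_dotp (convex_Icc _ _) _ _
        have hs : ∀ q, dotp (s • w') q = s * dotp w' q := fun q => smul_dotProduct s w' q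
        have := hψ'.2.2 _ hcon (fun q hq => by
          have h0 : 0 ≤ dotp w' q := dotp_nonneg (fun j => (hw _).le) hq.1
          have h1 : 0 ≤ dotp w' (1 - q) := dotp_nonneg (fun j => (hw _).le) (sub_nonneg.2 hq.2)
          have h2 : dotp w' 1 = dotp w' (1 - q) + dotp w' q := by rw [← dotp_add]; simp
          have := hsec (dotp w' q + w i + b) (by linarith [hw i]) (by linarith)
          rw [hs]
          linarith) p hpmem
        rw [hs] at this
        linarith }
  have hxcube : x ∈ Set.Icc (0 : Fin (n + 1) → ℝ) 1 :=
    ⟨fun j => (hx j).1.le, fun j => (hx j).2.le⟩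
  have hxlt : dotp w x + b < zhat := by
    by_contra! h
    exact hxnot (Or.inr ⟨hxcube, h⟩)
  obtain ⟨k, hk⟩ := Finite.exists_max x
  rw [map_sub, hDy, add_sub_cancel, hDgx]
  rw [dotp_succAbove i] at hxlt ⊢
  exact H.le_homogeneous (H.slope_le hψ' hTp hp1) (hx i).1.le (fun j => (hx _).1.le)
    (hx k).1 (hx k).2.le (hk i) (fun j => hk _) hxlt
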